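/- Let F₀, F₁ ∈ ℝ[x₀,x₁,x₂] be linearly independent homogeneous polynomials of degree 3. Then there exists (λ₀, λ₁) ∈ ℝ² ∖ {(0,0)} such that the real point set Z(λ₀F₀ + λ₁F₁) ⊆ ℝP² is nonempty and connected (in any real pencil of cubics there is a real cubic with connected real point set). -/

import Mathlib

noncomputable section

/-- The real projective plane, the projectivization of `ℝ³`. -/
abbrev RP2 := Projectivization ℝ (Fin 3 → ℝ)

/-- `ℝP²` carries the quotient topology from `ℝ³ ∖ {0}`. -/
instance : TopologicalSpace RP2 :=
  inferInstanceAs (TopologicalSpace (Quotient (projectivizationSetoid ℝ (Fin 3 → ℝ))))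

/-- The real point set of the plane curve defined by `F ∈ ℝ[x₀,x₁,x₂]`; for homogeneous `F`
this is well defined (independent of the representative). -/
def zeroSet (F : MvPolynomial (Fin 3) ℝ) : Set RP2 :=
  {p | MvPolynomial.eval p.rep F = 0}

/-- The set `S` lies in a single connected component of `Z ⊆ ℝP²` (with the subspace topology):
some connected component of `Z` contains `S`. -/
def inOneComponent (Z S : Set RP2) : Prop :=
  ∃ p ∈ Z, S ⊆ connectedComponentIn Z p

open Set Filter Topology

/-- A continuous map whose composition with `Complex.exp` is constant is itself constant. -/
lemma eq_of_exp_comp_eq_const {φ : ℝ → ℂ} (hφ : Continuous φ) {c : ℂ}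
    (h : ∀ t, Complex.exp (φ t) = c) (t t' : ℝ) : φ t = φ t' :=
  Complex.isCoveringMap_exp.const_of_comp hφ
    (fun a a' => Subtype.ext ((h a).trans (h a').symm)) t t'

/-- Borsuk–Ulam in dimension two: a continuous odd map `ℝ³ → ℂ` vanishes at some nonzero point. -/
lemma exists_ne_zero_eq_zero_of_odd {f : (Fin 3 → ℝ) → ℂ} (hf : Continuous f)
    (hodd : ∀ u, f (-u) = -f u) : ∃ u ≠ 0, f u = 0 := by
  by_contra! hne
  let H : ℝ × ℝ → Fin 3 → ℝ := fun p =>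
    ![Real.cos p.1 * Real.cos p.2, Real.cos p.1 * Real.sin p.2, Real.sin p.1]
  have hH : Continuous H := by
    refine continuous_pi fun i => ?_
    fin_cases i <;> simp [H] <;> fun_prop
  have hH0 : ∀ p, H p ≠ 0 := by
    intro p hp
    have h0 : Real.cos p.1 * Real.cos p.2 = 0 := congrFun hp 0
    have h1 : Real.cos p.1 * Real.sin p.2 = 0 := congrFun hp 1
    have h2 : Real.sin p.1 = 0 := congrFun hp 2
    have h3 := Real.sin_sq_add_cos_sq p.1
    have h4 := Real.sin_sq_add_cos_sq p.2
    have : (Real.cos p.1 * Real.cos p.2) ^ 2 + (Real.cos p.1 * Real.sin p.2) ^ 2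
        + Real.sin p.1 ^ 2 = 1 := by
      linear_combination h3 + Real.cos p.1 ^ 2 * h4
    rw [h0, h1, h2] at this
    norm_num at this
  have hfH : ∀ p, f (H p) ≠ 0 := fun p => hne _ (hH0 p)
  obtain ⟨G, ⟨-, hG⟩, -⟩ := Complex.isCoveringMap_exp.existsUnique_continuousMap_lifts
    (A := ℝ × ℝ) ⟨fun p => ⟨f (H p), hfH p⟩, by fun_prop⟩ (0, 0)
    (Complex.log (f (H (0, 0)))) (Subtype.ext (Complex.exp_log (hfH _)))
  have hexp : ∀ p, Complex.exp (G p) = f (H p) := fun p => congrArg Subtype.val (congrFun hG p)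
  have hGc : Continuous G := G.continuous
  have hhalf : ∀ t, Complex.exp (G (0, t + Real.pi) - G (0, t)) = -1 := by
    intro t
    have : H (0, t + Real.pi) = - H (0, t) := by
      ext i; fin_cases i <;> simp [H]
    rw [Complex.exp_sub, hexp, hexp, this, hodd, neg_div, div_self (hfH _)]
  have hfull : ∀ s, Complex.exp (G (s, 0 + Real.pi + Real.pi) - G (s, 0)) = 1 := by
    intro s
    have : H (s, 0 + Real.pi + Real.pi) = H (s, 0) := by
      ext i; fin_cases i <;> simp [H]
    rw [Complex.exp_sub, hexp, hexp, this, div_self (hfH _)]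
  have hpole : ∀ t, Complex.exp (G (Real.pi / 2, t)) = f (H (Real.pi / 2, 0)) := by
    intro t
    have : H (Real.pi / 2, t) = H (Real.pi / 2, 0) := by
      ext i; fin_cases i <;> simp [H]
    rw [hexp, this]
  have e1 := eq_of_exp_comp_eq_const (by fun_prop) hhalf 0 (0 + Real.pi)
  have e2 := eq_of_exp_comp_eq_const (by fun_prop) hfull 0 (Real.pi / 2)
  have e3 := eq_of_exp_comp_eq_const (by fun_prop) hpole (0 + Real.pi + Real.pi) 0
  have e4 := hhalf 0
  have e5 : G (0, 0 + Real.pi) - G (0, 0) = 0 := by linear_combination (e1 + e2 + e3) / 2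
  rw [e5, Complex.exp_zero] at e4
  norm_num at e4

/-- First and second order necessary conditions for a quartic polynomial to have a local minimum
at the origin. -/
lemma coeff_conditions_of_local_min {a b c d : ℝ}
    (h : ∀ᶠ τ in 𝓝 (0 : ℝ), 0 ≤ a * τ + b * τ ^ 2 + c * τ ^ 3 + d * τ ^ 4) : a = 0 ∧ 0 ≤ b := by
  have ha : a = 0 := by
    have hmin : IsLocalMin (fun τ : ℝ => a * τ + b * τ ^ 2 + c * τ ^ 3 + d * τ ^ 4) 0 := by
      filter_upwards [h] with τ hτ
      simpa using hτ
    have hder : HasDerivAt (fun τ : ℝ => a * τ + b * τ ^ 2 + c * τ ^ 3 + d * τ ^ 4) a 0 := by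
      have := ((((hasDerivAt_id (0 : ℝ)).const_mul a).add
        ((hasDerivAt_pow 2 (0 : ℝ)).const_mul b)).add
        ((hasDerivAt_pow 3 (0 : ℝ)).const_mul c)).add ((hasDerivAt_pow 4 (0 : ℝ)).const_mul d)
      convert! this using 1
      norm_num
    exact hmin.hasDerivAt_eq_zero hder
  refine ⟨ha, ?_⟩
  have hlim : Tendsto (fun τ : ℝ => b + c * τ + d * τ ^ 2) (𝓝[≠] 0) (𝓝 b) := by
    have : Continuous fun τ : ℝ => b + c * τ + d * τ ^ 2 := by fun_prop
    simpa using (this.tendsto 0).mono_left nhdsWithin_le_nhds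
  refine ge_of_tendsto hlim ?_
  filter_upwards [nhdsWithin_le_nhds h, self_mem_nhdsWithin] with τ hτ hne
  have h2 : 0 < τ ^ 2 := sq_pos_of_ne_zero hne
  refine nonneg_of_mul_nonneg_right (a := τ ^ 2) ?_ h2
  rw [ha] at hτ
  linarith

/-- A family of quartic polynomials `f₀ s`, nonnegative at the ends of an interval `[a s, 1]`,
taking a negative value inside for `s = 0` but not for `s = 1`, has a member with a degenerate
zero where the second derivative is nonnegative. -/
lemma exists_double_zero {f₀ f₁ f₂ f₃ f₄ : ℝ → ℝ → ℝ} {a : ℝ → ℝ}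
    (hf₀ : Continuous fun p : ℝ × ℝ => f₀ p.1 p.2) (hf₁ : Continuous fun p : ℝ × ℝ => f₁ p.1 p.2)
    (hf₂ : Continuous fun p : ℝ × ℝ => f₂ p.1 p.2) (ha : Continuous a)
    (htaylor : ∀ s t τ, f₀ s (t + τ) =
      f₀ s t + f₁ s t * τ + f₂ s t * τ ^ 2 + f₃ s t * τ ^ 3 + f₄ s t * τ ^ 4)
    (ha0 : ∀ s ∈ Icc (0 : ℝ) 1, 0 ≤ a s)
    (hleft : ∀ s ∈ Icc (0 : ℝ) 1, 0 ≤ f₀ s (a s)) (hright : ∀ s ∈ Icc (0 : ℝ) 1, 0 ≤ f₀ s 1)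
    (hstart : ∃ t ∈ Icc (a 0) 1, f₀ 0 t < 0) (hend : ∀ t ∈ Icc (a 1) 1, 0 ≤ f₀ 1 t) :
    ∃ s ∈ Icc (0 : ℝ) 1, ∃ t, f₀ s t = 0 ∧ f₁ s t = 0 ∧ 0 ≤ f₂ s t := by
  let N : Set ℝ := {s | ∃ t ∈ Ioo (a s) 1, f₀ s t < 0}
  have hN : IsOpen N := by
    have : N = ⋃ t, {s | a s < t ∧ t < 1 ∧ f₀ s t < 0} := by
      ext s; simp [N, and_assoc]
    rw [this]
    refine isOpen_iUnion fun t => ?_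
    have h1 : Continuous fun s => f₀ s t := hf₀.comp (by fun_prop : Continuous fun s : ℝ => (s, t))
    exact (isOpen_lt ha continuous_const).inter
      (isOpen_const.inter (isOpen_lt h1 continuous_const))
  have hIoo : ∀ s ∈ Icc (0 : ℝ) 1, ∀ t ∈ Icc (a s) 1, f₀ s t < 0 → t ∈ Ioo (a s) 1 := by
    intro s hs t ht hneg
    refine ⟨lt_of_le_of_ne ht.1 ?_, lt_of_le_of_ne ht.2 ?_⟩
    · rintro rfl; exact absurd (hleft s hs) (not_le.2 hneg)
    · rintro rfl; exact absurd (hright s hs) (not_le.2 hneg)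
  let K : Set (ℝ × ℝ) := (Icc 0 1 ×ˢ Icc 0 1) ∩
    {p | a p.1 ≤ p.2 ∧ f₀ p.1 p.2 ≤ 0 ∧ f₁ p.1 p.2 = 0 ∧ 0 ≤ f₂ p.1 p.2}
  have hK : IsCompact K := by
    refine (isCompact_Icc.prod isCompact_Icc).inter_right ?_
    exact (isClosed_le (ha.comp continuous_fst) continuous_snd).inter
      ((isClosed_le hf₀ continuous_const).inter
        ((isClosed_eq hf₁ continuous_const).inter (isClosed_le continuous_const hf₂)))
  have hNK : N ∩ Icc 0 1 ⊆ Prod.fst '' K := by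
    rintro s ⟨⟨t₀, ht₀, hneg⟩, hs⟩
    have hc : ContinuousOn (f₀ s) (Icc (a s) 1) :=
      (hf₀.comp (by fun_prop : Continuous fun t : ℝ => (s, t))).continuousOn
    obtain ⟨t, ht, hmin⟩ := isCompact_Icc.exists_isMinOn ⟨t₀, Ioo_subset_Icc_self ht₀⟩ hc
    have htneg : f₀ s t < 0 := (hmin (Ioo_subset_Icc_self ht₀)).trans_lt hneg
    have hti := hIoo s hs t ht htneg
    have hev : ∀ᶠ τ in 𝓝 (0 : ℝ),
        0 ≤ f₁ s t * τ + f₂ s t * τ ^ 2 + f₃ s t * τ ^ 3 + f₄ s t * τ ^ 4 := by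
      have hlim : Tendsto (fun τ : ℝ => t + τ) (𝓝 0) (𝓝 t) := by
        have : Continuous fun τ : ℝ => t + τ := by fun_prop
        simpa using this.tendsto 0
      filter_upwards [hlim (Icc_mem_nhds hti.1 hti.2)] with τ hτ
      have h1 : f₀ s t ≤ f₀ s (t + τ) := hmin hτ
      rw [htaylor] at h1
      linarith
    obtain ⟨h1, h2⟩ := coeff_conditions_of_local_min hev
    exact ⟨(s, t), ⟨⟨hs, (ha0 s hs).trans ht.1, ht.2⟩, ht.1, htneg.le, h1, h2⟩, rfl⟩
  have h0N : (0 : ℝ) ∈ N := by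
    obtain ⟨t, ht, hneg⟩ := hstart
    exact ⟨t, hIoo 0 (by simp) t ht hneg, hneg⟩
  have h1N : (1 : ℝ) ∉ N := by
    rintro ⟨t, ht, hneg⟩
    exact absurd (hend t (Ioo_subset_Icc_self ht)) (not_le.2 hneg)
  obtain ⟨s, hs, hsK, hsN⟩ : ∃ s ∈ Icc (0 : ℝ) 1, s ∈ Prod.fst '' K ∧ s ∉ N := by
    by_contra! hcon
    have hcover : Icc (0 : ℝ) 1 ⊆ N ∪ (Prod.fst '' K)ᶜ := fun s hs => by
      by_cases h : s ∈ Prod.fst '' K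
      · exact Or.inl (hcon s hs h)
      · exact Or.inr h
    obtain ⟨s, hs, hsN, hsK⟩ := isPreconnected_Icc N (Prod.fst '' K)ᶜ hN
      (hK.image continuous_fst).isClosed.isOpen_compl hcover ⟨0, by simp, h0N⟩
      ⟨1, by simp, fun h => h1N (hcon 1 (by simp) h)⟩
    exact hsK (hNK ⟨hsN, hs⟩)
  obtain ⟨⟨s', t⟩, ⟨⟨-, ht⟩, hat, h0, h1, h2⟩, rfl⟩ := hsK
  refine ⟨s', hs, t, le_antisymm h0 ?_, h1, h2⟩
  by_contra! hneg
  exact hsN ⟨t, hIoo s' hs t ⟨hat, ht.2⟩ hneg, hneg⟩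

/-- Linear form with coefficients `k 0, k 1`. -/
def linForm (k : Fin 9 → ℝ) (x y : ℝ) : ℝ := k 0 * x + k 1 * y

/-- Binary quadratic form with coefficients `k 2, k 3, k 4`. -/
def quadForm (k : Fin 9 → ℝ) (x y : ℝ) : ℝ := k 2 * x ^ 2 + k 3 * x * y + k 4 * y ^ 2

/-- Binary cubic form with coefficients `k 5, k 6, k 7, k 8`. -/
def cubForm (k : Fin 9 → ℝ) (x y : ℝ) : ℝ :=
  k 5 * x ^ 3 + k 6 * x ^ 2 * y + k 7 * x * y ^ 2 + k 8 * y ^ 3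

/-- The ternary cubic form `z² L + z Q + C`; every cubic through `[0 : 0 : 1]` is of this shape. -/
def cubicThrough (k : Fin 9 → ℝ) (x y z : ℝ) : ℝ :=
  z ^ 2 * linForm k x y + z * quadForm k x y + cubForm k x y

/-- The discriminant `Q² - 4 L C`, a binary quartic form on the pencil of lines through
`[0 : 0 : 1]`. -/
def disc (k : Fin 9 → ℝ) (x y : ℝ) : ℝ :=
  quadForm k x y ^ 2 - 4 * linForm k x y * cubForm k x y

/-- First polar of `quadForm`. -/
def quadPolar (k : Fin 9 → ℝ) (x y h h' : ℝ) : ℝ :=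
  2 * k 2 * x * h + k 3 * (x * h' + y * h) + 2 * k 4 * y * h'

/-- First polar of `cubForm`. -/
def cubPolar (k : Fin 9 → ℝ) (x y h h' : ℝ) : ℝ :=
  3 * k 5 * x ^ 2 * h + k 6 * (2 * x * y * h + x ^ 2 * h') + k 7 * (y ^ 2 * h + 2 * x * y * h')
    + 3 * k 8 * y ^ 2 * h'

/-- Linear Taylor coefficient of `disc k` at `(x, y)` in the direction `(h, h')`. -/
def disc₁ (k : Fin 9 → ℝ) (x y h h' : ℝ) : ℝ :=
  2 * quadForm k x y * quadPolar k x y h h'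
    - 4 * (linForm k x y * cubPolar k x y h h' + linForm k h h' * cubForm k x y)

/-- Quadratic Taylor coefficient of `disc k` at `(x, y)` in the direction `(h, h')`. -/
def disc₂ (k : Fin 9 → ℝ) (x y h h' : ℝ) : ℝ :=
  quadPolar k x y h h' ^ 2 + 2 * quadForm k x y * quadForm k h h'
    - 4 * (linForm k x y * cubPolar k h h' x y + linForm k h h' * cubPolar k x y h h')

lemma disc_comb (k : Fin 9 → ℝ) (a b x y h h' : ℝ) :
    disc k (a * x + b * h) (a * y + b * h') =
      a ^ 4 * disc k x y + a ^ 3 * b * disc₁ k x y h h' + a ^ 2 * b ^ 2 * disc₂ k x y h h'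
        + a * b ^ 3 * disc₁ k h h' x y + b ^ 4 * disc k h h' := by
  simp only [disc, disc₁, disc₂, linForm, quadForm, cubForm, quadPolar, cubPolar]
  ring

lemma disc_smul (k : Fin 9 → ℝ) (a x y : ℝ) : disc k (a * x) (a * y) = a ^ 4 * disc k x y := by
  simp only [disc, linForm, quadForm, cubForm]
  ring

lemma disc_neg (k : Fin 9 → ℝ) (x y : ℝ) : disc k (-x) (-y) = disc k x y := by
  have := disc_smul k (-1) x y
  norm_num at this
  exact this

lemma disc_eq_sq_of_linForm_eq_zero {k : Fin 9 → ℝ} {x y : ℝ} (h : linForm k x y = 0) :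
    disc k x y = quadForm k x y ^ 2 := by
  simp [disc, h]

/-- The locus `disc k ≥ 0` is star-shaped about `(g₁, g₂)` up to sign. -/
def DiscStar (k : Fin 9 → ℝ) (g₁ g₂ : ℝ) : Prop :=
  ∀ x y, 0 ≤ disc k x y →
    (∀ t ∈ Icc (0 : ℝ) 1, 0 ≤ disc k ((1 - t) * g₁ + t * x) ((1 - t) * g₂ + t * y)) ∨
    (∀ t ∈ Icc (0 : ℝ) 1, 0 ≤ disc k ((1 - t) * g₁ + t * -x) ((1 - t) * g₂ + t * -y))

/-- If `disc k` has a double zero at `g` with nonnegative second derivative, then it is a square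
times a quadratic form that is nonnegative at `g`, so `disc k ≥ 0` is star-shaped about `g`. -/
lemma discStar_of_double_zero {k : Fin 9 → ℝ} {g₁ g₂ h₁ h₂ : ℝ} (hdet : g₁ * h₂ - g₂ * h₁ ≠ 0)
    (h0 : disc k g₁ g₂ = 0) (h1 : disc₁ k g₁ g₂ h₁ h₂ = 0) (h2 : 0 ≤ disc₂ k g₁ g₂ h₁ h₂) :
    DiscStar k g₁ g₂ := by
  intro x y hxy
  obtain ⟨a, b, rfl, rfl⟩ : ∃ a b, x = a * g₁ + b * h₁ ∧ y = a * g₂ + b * h₂ :=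
    ⟨(x * h₂ - y * h₁) / (g₁ * h₂ - g₂ * h₁), (g₁ * y - g₂ * x) / (g₁ * h₂ - g₂ * h₁),
      by rw [div_mul_eq_mul_div, div_mul_eq_mul_div, ← add_div, eq_div_iff hdet]; ring,
      by rw [div_mul_eq_mul_div, div_mul_eq_mul_div, ← add_div, eq_div_iff hdet]; ring⟩
  rw [disc_comb, h0, h1] at hxy
  rcases le_total 0 (2 * a * disc₂ k g₁ g₂ h₁ h₂ + b * disc₁ k h₁ h₂ g₁ g₂) with hB | hB
  · left
    rintro t ⟨ht0, ht1⟩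
    rw [show (1 - t) * g₁ + t * (a * g₁ + b * h₁) = ((1 - t) + t * a) * g₁ + (t * b) * h₁ by ring,
      show (1 - t) * g₂ + t * (a * g₂ + b * h₂) = ((1 - t) + t * a) * g₂ + (t * b) * h₂ by ring,
      disc_comb, h0, h1]
    have ht : 0 ≤ 1 - t := by linarith
    have e1 := mul_nonneg (by positivity : 0 ≤ b ^ 2 * t ^ 2 * (1 - t) ^ 2) h2
    have e2 := mul_nonneg (by positivity : 0 ≤ b ^ 2 * t ^ 3 * (1 - t)) hB
    have e3 := mul_nonneg (by positivity : 0 ≤ t ^ 4) hxy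
    linear_combination e1 + e2 + e3
  · right
    rintro t ⟨ht0, ht1⟩
    rw [show (1 - t) * g₁ + t * -(a * g₁ + b * h₁)
        = ((1 - t) - t * a) * g₁ + (-t * b) * h₁ by ring,
      show (1 - t) * g₂ + t * -(a * g₂ + b * h₂)
        = ((1 - t) - t * a) * g₂ + (-t * b) * h₂ by ring,
      disc_comb, h0, h1]
    have ht : 0 ≤ 1 - t := by linarith
    have e1 := mul_nonneg (by positivity : 0 ≤ b ^ 2 * t ^ 2 * (1 - t) ^ 2) h2
    have e2 := mul_nonneg (by positivity : 0 ≤ b ^ 2 * t ^ 3 * (1 - t)) (neg_nonneg.2 hB)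
    have e3 := mul_nonneg (by positivity : 0 ≤ t ^ 4) hxy
    linear_combination e1 + e2 + e3

/-- A zero `e` of `disc k` is independent of `v` as soon as `disc k` is negative somewhere on the
segment from `e` to `v`. -/
lemma det_ne_zero_of_disc_neg {k : Fin 9 → ℝ} {e₁ e₂ v₁ v₂ t : ℝ} (he : ¬(e₁ = 0 ∧ e₂ = 0))
    (h0 : disc k e₁ e₂ = 0)
    (hneg : disc k ((1 - t) * e₁ + t * v₁) ((1 - t) * e₂ + t * v₂) < 0) :
    e₁ * v₂ - e₂ * v₁ ≠ 0 := by
  intro hdet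
  have hs : 0 < e₁ ^ 2 + e₂ ^ 2 := by
    rcases not_and_or.1 he with h | h <;> positivity
  have hv₁ : v₁ = (e₁ * v₁ + e₂ * v₂) / (e₁ ^ 2 + e₂ ^ 2) * e₁ := by
    field_simp
    linear_combination - e₂ * hdet
  have hv₂ : v₂ = (e₁ * v₁ + e₂ * v₂) / (e₁ ^ 2 + e₂ ^ 2) * e₂ := by
    field_simp
    linear_combination e₁ * hdet
  set c := (e₁ * v₁ + e₂ * v₂) / (e₁ ^ 2 + e₂ ^ 2)
  rw [hv₁, hv₂, show (1 - t) * e₁ + t * (c * e₁) = (1 - t + t * c) * e₁ by ring,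
    show (1 - t) * e₂ + t * (c * e₂) = (1 - t + t * c) * e₂ by ring, disc_smul, h0] at hneg
  simp at hneg

/-- The segment from `κ` to `κ'`, in coefficient space. -/
def coeffSegment (κ κ' : Fin 9 → ℝ) (s : ℝ) : Fin 9 → ℝ := (1 - s) • κ + s • κ'

lemma exists_discStar_on_segment {κ κ' : Fin 9 → ℝ} {e₁ e₂ v₁ v₂ : ℝ} {a : ℝ → ℝ}
    (hdet : e₁ * v₂ - e₂ * v₁ ≠ 0) (ha : Continuous a) (ha0 : ∀ s ∈ Icc (0 : ℝ) 1, 0 ≤ a s)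
    (hleft : ∀ s ∈ Icc (0 : ℝ) 1, 0 ≤ disc (coeffSegment κ κ' s)
      ((1 - a s) * e₁ + a s * v₁) ((1 - a s) * e₂ + a s * v₂))
    (hright : ∀ s ∈ Icc (0 : ℝ) 1, 0 ≤ disc (coeffSegment κ κ' s) v₁ v₂)
    (hstart : ∃ t ∈ Icc (a 0) 1, disc κ ((1 - t) * e₁ + t * v₁) ((1 - t) * e₂ + t * v₂) < 0)
    (hend : ∀ t ∈ Icc (a 1) 1, 0 ≤ disc κ' ((1 - t) * e₁ + t * v₁) ((1 - t) * e₂ + t * v₂)) :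
    ∃ s ∈ Icc (0 : ℝ) 1, ∃ g₁ g₂, ¬(g₁ = 0 ∧ g₂ = 0) ∧ disc (coeffSegment κ κ' s) g₁ g₂ = 0 ∧
      DiscStar (coeffSegment κ κ' s) g₁ g₂ := by
  obtain ⟨s, hs, t, h0, h1, h2⟩ := exists_double_zero
    (f₀ := fun s t => disc (coeffSegment κ κ' s) ((1 - t) * e₁ + t * v₁) ((1 - t) * e₂ + t * v₂))
    (f₁ := fun s t => disc₁ (coeffSegment κ κ' s) ((1 - t) * e₁ + t * v₁)
      ((1 - t) * e₂ + t * v₂) (v₁ - e₁) (v₂ - e₂))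
    (f₂ := fun s t => disc₂ (coeffSegment κ κ' s) ((1 - t) * e₁ + t * v₁)
      ((1 - t) * e₂ + t * v₂) (v₁ - e₁) (v₂ - e₂))
    (f₃ := fun s t => disc₁ (coeffSegment κ κ' s) (v₁ - e₁) (v₂ - e₂) ((1 - t) * e₁ + t * v₁)
      ((1 - t) * e₂ + t * v₂))
    (f₄ := fun s _ => disc (coeffSegment κ κ' s) (v₁ - e₁) (v₂ - e₂))
    (a := a)
    (by simp only [disc, linForm, quadForm, cubForm, coeffSegment, Pi.add_apply, Pi.smul_apply,
          smul_eq_mul]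
        fun_prop)
    (by simp only [disc₁, linForm, quadForm, cubForm, quadPolar, cubPolar, coeffSegment,
          Pi.add_apply, Pi.smul_apply, smul_eq_mul]
        fun_prop)
    (by simp only [disc₂, linForm, quadForm, quadPolar, cubPolar, coeffSegment,
          Pi.add_apply, Pi.smul_apply, smul_eq_mul]
        fun_prop)
    ha
    (fun s t τ => by
      have := disc_comb (coeffSegment κ κ' s) 1 τ ((1 - t) * e₁ + t * v₁)
        ((1 - t) * e₂ + t * v₂) (v₁ - e₁) (v₂ - e₂)
      rw [show (1 - (t + τ)) * e₁ + (t + τ) * v₁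
          = 1 * ((1 - t) * e₁ + t * v₁) + τ * (v₁ - e₁) by ring,
        show (1 - (t + τ)) * e₂ + (t + τ) * v₂
          = 1 * ((1 - t) * e₂ + t * v₂) + τ * (v₂ - e₂) by ring, this]
      ring)
    ha0 hleft (by simpa using hright) (by simpa [coeffSegment] using hstart)
    (by simpa [coeffSegment] using hend)
  have hdet' : ((1 - t) * e₁ + t * v₁) * (v₂ - e₂) - ((1 - t) * e₂ + t * v₂) * (v₁ - e₁) ≠ 0 := by
    rwa [show ((1 - t) * e₁ + t * v₁) * (v₂ - e₂) - ((1 - t) * e₂ + t * v₂) * (v₁ - e₁)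
      = e₁ * v₂ - e₂ * v₁ by ring]
  refine ⟨s, hs, _, _, ?_, h0, discStar_of_double_zero hdet' h0 h1 h2⟩
  rintro ⟨hg₁, hg₂⟩
  rw [hg₁, hg₂] at hdet'
  simp at hdet'

/-- After changing the sign of `κ'` if necessary, `disc · x y` is nonnegative on the segment
joining two coefficient vectors where it is nonnegative. -/
lemma disc_nonneg_on_segment_or {κ κ' : Fin 9 → ℝ} {x y : ℝ} (h : 0 ≤ disc κ x y)
    (h' : 0 ≤ disc κ' x y) :
    (∀ s ∈ Icc (0 : ℝ) 1, 0 ≤ disc (coeffSegment κ κ' s) x y) ∨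
    (∀ s ∈ Icc (0 : ℝ) 1, 0 ≤ disc (coeffSegment κ (-κ') s) x y) := by
  let B : ℝ := 2 * quadForm κ x y * quadForm κ' x y
    - 4 * (linForm κ x y * cubForm κ' x y + linForm κ' x y * cubForm κ x y)
  have e1 : ∀ s, disc (coeffSegment κ κ' s) x y
      = (1 - s) ^ 2 * disc κ x y + s * (1 - s) * B + s ^ 2 * disc κ' x y := by
    intro s
    simp only [disc, linForm, quadForm, cubForm, coeffSegment, Pi.add_apply, Pi.smul_apply,
      smul_eq_mul, B]
    ring
  have e2 : ∀ s, disc (coeffSegment κ (-κ') s) x y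
      = (1 - s) ^ 2 * disc κ x y + s * (1 - s) * -B + s ^ 2 * disc κ' x y := by
    intro s
    simp only [disc, linForm, quadForm, cubForm, coeffSegment, Pi.add_apply, Pi.smul_apply,
      Pi.neg_apply, smul_eq_mul, B]
    ring
  rcases le_total 0 B with hB | hB
  · left
    rintro s ⟨hs0, hs1⟩
    have : 0 ≤ 1 - s := by linarith
    rw [e1]
    positivity
  · right
    rintro s ⟨hs0, hs1⟩
    have : 0 ≤ 1 - s := by linarith
    have : 0 ≤ -B := by linarith
    rw [e2]
    positivity

lemma exists_ne_zero_mul_add_mul_eq_zero (a b : ℝ) :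
    ∃ p q : ℝ, ¬(p = 0 ∧ q = 0) ∧ p * a + q * b = 0 := by
  by_cases h : a = 0
  · exact ⟨1, 0, by simp, by simp [h]⟩
  · exact ⟨-b, a, by simp [h], by ring⟩

lemma exists_ne_zero_of_det_eq_zero {a b c d : ℝ} (h : a * d - b * c = 0) :
    ∃ p q : ℝ, ¬(p = 0 ∧ q = 0) ∧ p * a + q * b = 0 ∧ p * c + q * d = 0 := by
  by_cases hab : a = 0 ∧ b = 0
  · obtain ⟨p, q, hpq, h0⟩ := exists_ne_zero_mul_add_mul_eq_zero c d
    exact ⟨p, q, hpq, by simp [hab.1, hab.2], h0⟩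
  · exact ⟨-b, a, by simpa [and_comm] using hab, by ring, by linear_combination h⟩

lemma linForm_comb (k₀ k₁ : Fin 9 → ℝ) (p q x y : ℝ) :
    linForm (p • k₀ + q • k₁) x y = p * linForm k₀ x y + q * linForm k₁ x y := by
  simp only [linForm, Pi.add_apply, Pi.smul_apply, smul_eq_mul]; ring

lemma quadForm_comb (k₀ k₁ : Fin 9 → ℝ) (p q x y : ℝ) :
    quadForm (p • k₀ + q • k₁) x y = p * quadForm k₀ x y + q * quadForm k₁ x y := by
  simp only [quadForm, Pi.add_apply, Pi.smul_apply, smul_eq_mul]; ring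

lemma coeffSegment_comb (k₀ k₁ : Fin 9 → ℝ) (p q p' q' s : ℝ) :
    coeffSegment (p • k₀ + q • k₁) (p' • k₀ + q' • k₁) s
      = ((1 - s) * p + s * p') • k₀ + ((1 - s) * q + s * q') • k₁ := by
  simp only [coeffSegment]; module

lemma exists_neg_of_not_discStar {k : Fin 9 → ℝ} {e₁ e₂ : ℝ} (h : ¬ DiscStar k e₁ e₂) :
    ∃ x y, 0 ≤ disc k x y ∧
      (∃ t ∈ Icc (0 : ℝ) 1, disc k ((1 - t) * e₁ + t * x) ((1 - t) * e₂ + t * y) < 0) ∧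
      (∃ t ∈ Icc (0 : ℝ) 1, disc k ((1 - t) * e₁ + t * -x) ((1 - t) * e₂ + t * -y) < 0) := by
  unfold DiscStar at h
  push Not at h
  exact h

/-- The case in which the tangent directions at the base point do not vary in the pencil. -/
lemma exists_discStar_of_det_eq_zero {k₀ k₁ : Fin 9 → ℝ} (hdet : k₀ 0 * k₁ 1 - k₀ 1 * k₁ 0 = 0) :
    ∃ p q : ℝ, ¬(p = 0 ∧ q = 0) ∧ ∃ g₁ g₂ : ℝ, ¬(g₁ = 0 ∧ g₂ = 0) ∧
      disc (p • k₀ + q • k₁) g₁ g₂ = 0 ∧ DiscStar (p • k₀ + q • k₁) g₁ g₂ := by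
  obtain ⟨e₁, e₂, he, he₀, he₁⟩ := exists_ne_zero_of_det_eq_zero hdet
  have hL₀ : linForm k₀ e₁ e₂ = 0 := by rw [linForm]; linarith
  have hL₁ : linForm k₁ e₁ e₂ = 0 := by rw [linForm]; linarith
  obtain ⟨p', q', hpq', hp', hq'⟩ := exists_ne_zero_of_det_eq_zero
    (show k₀ 0 * k₁ 1 - k₁ 0 * k₀ 1 = 0 by linarith)
  have hL' : ∀ x y, linForm (p' • k₀ + q' • k₁) x y = 0 := by
    intro x y
    simp only [linForm, Pi.add_apply, Pi.smul_apply, smul_eq_mul]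
    linear_combination x * hp' + y * hq'
  have hD' : ∀ x y, 0 ≤ disc (p' • k₀ + q' • k₁) x y := fun x y => by
    rw [disc_eq_sq_of_linForm_eq_zero (hL' x y)]; positivity
  obtain ⟨p, q, hpq, hQ⟩ := exists_ne_zero_mul_add_mul_eq_zero (quadForm k₀ e₁ e₂)
    (quadForm k₁ e₁ e₂)
  have hDe : disc (p • k₀ + q • k₁) e₁ e₂ = 0 := by
    rw [disc_eq_sq_of_linForm_eq_zero (by rw [linForm_comb, hL₀, hL₁]; ring), quadForm_comb, hQ]
    norm_num
  by_cases hstar : DiscStar (p • k₀ + q • k₁) e₁ e₂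
  · exact ⟨p, q, hpq, e₁, e₂, he, hDe, hstar⟩
  obtain ⟨v₁, v₂, hv, ⟨t, ht, hneg⟩, -⟩ := exists_neg_of_not_discStar hstar
  obtain ⟨p'', q'', hpq'', hL'', hD'', hseg⟩ : ∃ p'' q'' : ℝ, ¬(p'' = 0 ∧ q'' = 0) ∧
      (∀ x y, linForm (p'' • k₀ + q'' • k₁) x y = 0) ∧
      (∀ x y, 0 ≤ disc (p'' • k₀ + q'' • k₁) x y) ∧ ∀ s ∈ Icc (0 : ℝ) 1,
        0 ≤ disc (coeffSegment (p • k₀ + q • k₁) (p'' • k₀ + q'' • k₁) s) v₁ v₂ := by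
    rcases disc_nonneg_on_segment_or hv (hD' v₁ v₂) with h | h
    · exact ⟨p', q', hpq', hL', hD', h⟩
    · have hk : -(p' • k₀ + q' • k₁) = (-p') • k₀ + (-q') • k₁ := by module
      have hL'' : ∀ x y, linForm ((-p') • k₀ + (-q') • k₁) x y = 0 := by
        intro x y
        have := hL' x y
        rw [linForm_comb] at this ⊢
        linarith
      refine ⟨-p', -q', by simpa using hpq', hL'', fun x y => ?_, by rwa [hk] at h⟩
      rw [disc_eq_sq_of_linForm_eq_zero (hL'' x y)]; positivity
  obtain ⟨s, hs, g₁, g₂, hg, h0, hst⟩ := exists_discStar_on_segment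
    (det_ne_zero_of_disc_neg he hDe hneg) (a := fun _ => 0) continuous_const (fun _ _ => le_rfl)
    (fun s _ => by
      rw [coeffSegment_comb]
      simp only [sub_zero, one_mul, zero_mul, add_zero]
      rw [disc_eq_sq_of_linForm_eq_zero (by rw [linForm_comb, hL₀, hL₁]; ring)]
      positivity) hseg ⟨t, ht, hneg⟩ (fun _ _ => hD'' _ _)
  rw [coeffSegment_comb] at h0 hst
  refine ⟨_, _, ?_, g₁, g₂, hg, h0, hst⟩
  rintro ⟨h1, h2⟩
  have hs1 : 1 - s ≠ 0 := by
    intro h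
    obtain rfl : s = 1 := by linarith
    exact hpq'' ⟨by linarith, by linarith⟩
  refine absurd hneg (not_lt.2 ?_)
  rw [disc_eq_sq_of_linForm_eq_zero]
  · positivity
  · refine (mul_eq_zero.1 (?_ : (1 - s) * _ = 0)).resolve_left hs1
    have := hL'' ((1 - t) * e₁ + t * v₁) ((1 - t) * e₂ + t * v₂)
    rw [linForm_comb] at this ⊢
    linear_combination h1 * linForm k₀ ((1 - t) * e₁ + t * v₁) ((1 - t) * e₂ + t * v₂)
      + h2 * linForm k₁ ((1 - t) * e₁ + t * v₁) ((1 - t) * e₂ + t * v₂) - s * this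

/-- The case in which the tangent directions at the base point vary in the pencil. Some member
has an inflection point at the base point. -/
lemma exists_discStar_of_det_ne_zero {k₀ k₁ : Fin 9 → ℝ} (hdet : k₀ 0 * k₁ 1 - k₀ 1 * k₁ 0 ≠ 0) :
    ∃ p q : ℝ, ¬(p = 0 ∧ q = 0) ∧ ∃ g₁ g₂ : ℝ, ¬(g₁ = 0 ∧ g₂ = 0) ∧
      disc (p • k₀ + q • k₁) g₁ g₂ = 0 ∧ DiscStar (p • k₀ + q • k₁) g₁ g₂ := by
  let E₁ : ℝ → ℝ → ℝ := fun p q => -(p * k₀ 1 + q * k₁ 1)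
  let E₂ : ℝ → ℝ → ℝ := fun p q => p * k₀ 0 + q * k₁ 0
  have hLE : ∀ p q, linForm (p • k₀ + q • k₁) (E₁ p q) (E₂ p q) = 0 := by
    intro p q
    simp only [linForm, Pi.add_apply, Pi.smul_apply, smul_eq_mul, E₁, E₂]
    ring
  have hDE : ∀ p q, disc (p • k₀ + q • k₁) (E₁ p q) (E₂ p q)
      = quadForm (p • k₀ + q • k₁) (E₁ p q) (E₂ p q) ^ 2 :=
    fun p q => disc_eq_sq_of_linForm_eq_zero (hLE p q)
  have hE0 : ∀ p q, E₁ p q = 0 ∧ E₂ p q = 0 → p = 0 ∧ q = 0 := by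
    rintro p q ⟨h1, h2⟩
    simp only [E₁, E₂] at h1 h2
    constructor
    · refine (mul_eq_zero.1 (?_ : _ * p = 0)).resolve_left hdet
      linear_combination k₁ 1 * h2 + k₁ 0 * h1
    · refine (mul_eq_zero.1 (?_ : _ * q = 0)).resolve_left hdet
      linear_combination - k₀ 1 * h2 - k₀ 0 * h1
  have hEsurj : ∀ x y, ∃ p q, E₁ p q = x ∧ E₂ p q = y := by
    intro x y
    refine ⟨(k₁ 1 * y + k₁ 0 * x) / (k₀ 0 * k₁ 1 - k₀ 1 * k₁ 0),
      -(k₀ 1 * y + k₀ 0 * x) / (k₀ 0 * k₁ 1 - k₀ 1 * k₁ 0), ?_, ?_⟩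
    · simp only [E₁]
      rw [div_mul_eq_mul_div, div_mul_eq_mul_div, ← add_div, ← neg_div, div_eq_iff hdet]; ring
    · simp only [E₂]
      rw [div_mul_eq_mul_div, div_mul_eq_mul_div, ← add_div, div_eq_iff hdet]; ring
  obtain ⟨p, q, hpq, hQ⟩ : ∃ p q : ℝ, ¬(p = 0 ∧ q = 0) ∧
      quadForm (p • k₀ + q • k₁) (E₁ p q) (E₂ p q) = 0 := by
    let φ : ℝ → ℝ := fun θ => quadForm (Real.cos θ • k₀ + Real.sin θ • k₁)
      (E₁ (Real.cos θ) (Real.sin θ)) (E₂ (Real.cos θ) (Real.sin θ))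
    have hφ : Continuous φ := by
      simp only [φ, quadForm, Pi.add_apply, Pi.smul_apply, smul_eq_mul, E₁, E₂]
      fun_prop
    have hodd : φ Real.pi = - φ 0 := by
      simp only [φ, quadForm, Pi.add_apply, Pi.smul_apply, smul_eq_mul, E₁, E₂, Real.cos_pi,
        Real.sin_pi, Real.cos_zero, Real.sin_zero]
      ring
    obtain ⟨θ, hθ⟩ : (0 : ℝ) ∈ range φ := by
      refine mem_range_of_exists_le_of_exists_ge hφ ?_ ?_
      · rcases le_total (φ 0) 0 with h | h
        · exact ⟨0, h⟩
        · exact ⟨Real.pi, by linarith⟩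
      · rcases le_total (φ 0) 0 with h | h
        · exact ⟨Real.pi, by linarith⟩
        · exact ⟨0, h⟩
    refine ⟨Real.cos θ, Real.sin θ, ?_, hθ⟩
    rintro ⟨hc, hs⟩
    have := Real.sin_sq_add_cos_sq θ
    rw [hc, hs] at this
    norm_num at this
  have he : ¬(E₁ p q = 0 ∧ E₂ p q = 0) := fun h => hpq (hE0 p q h)
  have hDe : disc (p • k₀ + q • k₁) (E₁ p q) (E₂ p q) = 0 := by rw [hDE, hQ]; norm_num
  by_cases hstar : DiscStar (p • k₀ + q • k₁) (E₁ p q) (E₂ p q)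
  · exact ⟨p, q, hpq, _, _, he, hDe, hstar⟩
  obtain ⟨v₁, v₂, hv, hneg, hneg'⟩ := exists_neg_of_not_discStar hstar
  obtain ⟨p', q', ⟨t, ht, hneg⟩, hseg⟩ : ∃ p' q' : ℝ,
      (∃ t ∈ Icc (0 : ℝ) 1, disc (p • k₀ + q • k₁) ((1 - t) * E₁ p q + t * E₁ p' q')
        ((1 - t) * E₂ p q + t * E₂ p' q') < 0) ∧ ∀ s ∈ Icc (0 : ℝ) 1,
        0 ≤ disc (coeffSegment (p • k₀ + q • k₁) (p' • k₀ + q' • k₁) s) (E₁ p' q') (E₂ p' q') := by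
    obtain ⟨p', q', rfl, rfl⟩ := hEsurj v₁ v₂
    have hv' : 0 ≤ disc (p' • k₀ + q' • k₁) (E₁ p' q') (E₂ p' q') := by rw [hDE]; positivity
    rcases disc_nonneg_on_segment_or hv hv' with h | h
    · exact ⟨p', q', hneg, h⟩
    · have hk : -(p' • k₀ + q' • k₁) = (-p') • k₀ + (-q') • k₁ := by module
      have hn₁ : E₁ (-p') (-q') = - E₁ p' q' := by simp only [E₁]; ring
      have hn₂ : E₂ (-p') (-q') = - E₂ p' q' := by simp only [E₂]; ring
      refine ⟨-p', -q', by rwa [hn₁, hn₂], fun s hs => ?_⟩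
      rw [hn₁, hn₂, disc_neg, ← hk]
      exact h s hs
  have hElin₁ : ∀ s, (1 - s) * E₁ p q + s * E₁ p' q'
      = E₁ ((1 - s) * p + s * p') ((1 - s) * q + s * q') := fun s => by simp only [E₁]; ring
  have hElin₂ : ∀ s, (1 - s) * E₂ p q + s * E₂ p' q'
      = E₂ ((1 - s) * p + s * p') ((1 - s) * q + s * q') := fun s => by simp only [E₂]; ring
  have hind := det_ne_zero_of_disc_neg he hDe hneg
  obtain ⟨s, hs, g₁, g₂, hg, h0, hst⟩ := exists_discStar_on_segment
    hind (a := fun s => s) continuous_id (fun _ hs => hs.1)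
    (fun s _ => by
      rw [coeffSegment_comb, hElin₁, hElin₂, hDE]
      positivity) hseg ⟨t, ht, hneg⟩
    (fun t ht => by
      obtain rfl : t = 1 := le_antisymm ht.2 ht.1
      simp only [sub_self, zero_mul, one_mul, zero_add, hDE]
      positivity)
  rw [coeffSegment_comb] at h0 hst
  refine ⟨_, _, ?_, g₁, g₂, hg, h0, hst⟩
  rintro ⟨h1, h2⟩
  have h3 := hElin₁ s
  have h4 := hElin₂ s
  rw [h1, h2] at h3 h4
  simp only [E₁, E₂, zero_mul, add_zero, neg_zero] at h3 h4 hind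
  rcases eq_or_ne s 0 with rfl | hs0
  · exact he ⟨by simpa [E₁] using h3, by simpa [E₂] using h4⟩
  · refine hind ((mul_eq_zero.1 (?_ : s * _ = 0)).resolve_left hs0)
    linear_combination (-(p * k₀ 1 + q * k₁ 1)) * h4 - (p * k₀ 0 + q * k₁ 0) * h3

lemma exists_discStar (k₀ k₁ : Fin 9 → ℝ) :
    ∃ p q : ℝ, ¬(p = 0 ∧ q = 0) ∧ ∃ g₁ g₂ : ℝ, ¬(g₁ = 0 ∧ g₂ = 0) ∧
      disc (p • k₀ + q • k₁) g₁ g₂ = 0 ∧ DiscStar (p • k₀ + q • k₁) g₁ g₂ := by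
  by_cases hdet : k₀ 0 * k₁ 1 - k₀ 1 * k₁ 0 = 0
  · exact exists_discStar_of_det_eq_zero hdet
  · exact exists_discStar_of_det_ne_zero hdet

/-- `(z, w)` spans a root of the quadratic form cut out on the line over `(x, y)` by the residual
intersection with the cubic. -/
def IsResidualRoot (k : Fin 9 → ℝ) (x y z w : ℝ) : Prop :=
  ¬(z = 0 ∧ w = 0) ∧
    linForm k x y * z ^ 2 + quadForm k x y * z * w + cubForm k x y * w ^ 2 = 0

/-- The affine cone over the cubic, without its vertex. -/
def cubicCone (k : Fin 9 → ℝ) : Set (ℝ × ℝ × ℝ) :=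
  {p | p ≠ 0 ∧ cubicThrough k p.1 p.2.1 p.2.2 = 0}

lemma IsResidualRoot.mem_cubicCone {k : Fin 9 → ℝ} {x y z w : ℝ} (hxy : ¬(x = 0 ∧ y = 0))
    (h : IsResidualRoot k x y z w) : (w * x, w * y, z) ∈ cubicCone k := by
  obtain ⟨hne, h⟩ := h
  refine ⟨fun h0 => ?_, ?_⟩
  · simp only [Prod.mk_eq_zero, mul_eq_zero] at h0
    tauto
  · simp only [cubicThrough, linForm, quadForm, cubForm] at h ⊢
    linear_combination w * h

lemma IsResidualRoot.disc_nonneg {k : Fin 9 → ℝ} {x y z w : ℝ}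
    (h : IsResidualRoot k x y z w) : 0 ≤ disc k x y := by
  obtain ⟨hne, h⟩ := h
  by_cases hw : w = 0
  · have hz : z ≠ 0 := fun hz => hne ⟨hz, hw⟩
    have hL : linForm k x y = 0 := by simpa [hw, hz] using h
    rw [disc_eq_sq_of_linForm_eq_zero hL]
    positivity
  · have hw2 : 0 < w ^ 2 := by positivity
    refine nonneg_of_mul_nonneg_right (a := w ^ 2) ?_ hw2
    have : w ^ 2 * disc k x y = (2 * linForm k x y * z + quadForm k x y * w) ^ 2 := by
      rw [disc]; linear_combination -4 * linForm k x y * h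
    rw [this]
    positivity

lemma exists_isResidualRoot {k : Fin 9 → ℝ} {x y : ℝ} (h : 0 ≤ disc k x y) :
    ∃ z w, IsResidualRoot k x y z w := by
  by_cases hL : linForm k x y = 0
  · exact ⟨1, 0, by simp, by simp [hL]⟩
  · refine ⟨-quadForm k x y + Real.sqrt (disc k x y), 2 * linForm k x y, by simp [hL], ?_⟩
    have hs := Real.sq_sqrt h
    rw [disc] at hs ⊢
    linear_combination linForm k x y * hs

/-- A continuous two-colouring of the projective cubic, as a function on its cone. -/
structure IsConeColouring (k : Fin 9 → ℝ) (χ : ℝ × ℝ × ℝ → Bool) : Prop where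
  continuousOn : ContinuousOn χ (cubicCone k)
  smul_eq : ∀ c : ℝ, c ≠ 0 → ∀ p, χ (c • p) = χ p

namespace IsConeColouring

variable {k : Fin 9 → ℝ} {χ : ℝ × ℝ × ℝ → Bool}

lemma root_smul (hχ : IsConeColouring k χ) {c : ℝ} (hc : c ≠ 0) (x y z w : ℝ) :
    χ (c * w * x, c * w * y, c * z) = χ (w * x, w * y, z) := by
  rw [← hχ.smul_eq c hc (w * x, w * y, z)]
  simp [mul_assoc]

lemma exists_unit_root (hχ : IsConeColouring k χ) {x y z w : ℝ} (h : IsResidualRoot k x y z w) :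
    ∃ z' w', z' ^ 2 + w' ^ 2 = 1 ∧ IsResidualRoot k x y z' w' ∧
      χ (w' * x, w' * y, z') = χ (w * x, w * y, z) := by
  have hpos : 0 < z ^ 2 + w ^ 2 := by
    rcases not_and_or.1 h.1 with h | h <;> positivity
  have hr := Real.sqrt_pos.2 hpos
  have hr2 := Real.sq_sqrt hpos.le
  set r := Real.sqrt (z ^ 2 + w ^ 2)
  refine ⟨r⁻¹ * z, r⁻¹ * w, ?_, ⟨?_, ?_⟩, hχ.root_smul (inv_ne_zero hr.ne') x y z w⟩
  · field_simp
    exact hr2.symm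
  · simpa [hr.ne'] using h.1
  · linear_combination r⁻¹ ^ 2 * h.2

/-- Over a zero of the discriminant all points have the same colour. -/
lemma eq_of_disc_eq_zero (hχ : IsConeColouring k χ) {x y z w z' w' : ℝ} (hxy : ¬(x = 0 ∧ y = 0))
    (hD : disc k x y = 0) (h : IsResidualRoot k x y z w) (h' : IsResidualRoot k x y z' w') :
    χ (w * x, w * y, z) = χ (w' * x, w' * y, z') := by
  by_cases hdet : z * w' - z' * w = 0
  · have hpos : z ^ 2 + w ^ 2 ≠ 0 := by
      rcases not_and_or.1 h.1 with h | h <;> positivity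
    have hz : z' = (z * z' + w * w') / (z ^ 2 + w ^ 2) * z := by
      field_simp
      linear_combination - w * hdet
    have hw : w' = (z * z' + w * w') / (z ^ 2 + w ^ 2) * w := by
      field_simp
      linear_combination z * hdet
    set c := (z * z' + w * w') / (z ^ 2 + w ^ 2)
    have hc : c ≠ 0 := by
      intro hc
      rw [hc, zero_mul] at hz hw
      exact h'.1 ⟨hz, hw⟩
    rw [hz, hw, hχ.root_smul hc]
  · have hpolar : 2 * linForm k x y * z * z' + quadForm k x y * (z * w' + z' * w)
        + 2 * cubForm k x y * w * w' = 0 := by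
      refine pow_eq_zero_iff (two_ne_zero) |>.1 ?_
      rw [disc] at hD
      linear_combination (z * w' - z' * w) ^ 2 * hD + 4 *
        (linForm k x y * z' ^ 2 + quadForm k x y * z' * w' + cubForm k x y * w' ^ 2) * h.2
    let γ : ℝ → ℝ × ℝ × ℝ := fun t => (((1 - t) * w + t * w') * x, ((1 - t) * w + t * w') * y,
      (1 - t) * z + t * z')
    have hγ : ∀ t, γ t ∈ cubicCone k := by
      intro t
      refine IsResidualRoot.mem_cubicCone hxy ⟨?_, ?_⟩
      · rintro ⟨h1, h2⟩
        have e1 : (1 - t) * (z * w' - z' * w) = 0 := by linear_combination w' * h1 - z' * h2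
        have e2 : t * (z * w' - z' * w) = 0 := by linear_combination z * h2 - w * h1
        exact hdet (by linear_combination e1 + e2)
      · linear_combination (1 - t) ^ 2 * h.2 + t ^ 2 * h'.2 + t * (1 - t) * hpolar
    have hc : ContinuousOn (χ ∘ γ) univ :=
      hχ.continuousOn.comp (by fun_prop) fun t _ => hγ t
    have := isPreconnected_univ.constant hc (mem_univ (0 : ℝ)) (mem_univ (1 : ℝ))
    simpa [γ] using this

/-- A root is an eigenvector of the traceless matrix
associated with the quadratic form. -/
lemma _root_.IsResidualRoot.exists_eigenvalue {x y z w : ℝ} (h : IsResidualRoot k x y z w) :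
    ∃ ε : ℝ, ε ^ 2 = 1 ∧
      -quadForm k x y * z - 2 * cubForm k x y * w = ε * Real.sqrt (disc k x y) * z ∧
      2 * linForm k x y * z + quadForm k x y * w = ε * Real.sqrt (disc k x y) * w := by
  have hs := Real.sq_sqrt h.disc_nonneg
  set s := Real.sqrt (disc k x y)
  by_cases hw : w = 0
  · have hz : z ≠ 0 := fun hz => h.1 ⟨hz, hw⟩
    have hL : linForm k x y = 0 := by simpa [hw, hz] using h.2
    rw [disc_eq_sq_of_linForm_eq_zero hL, sq_eq_sq_iff_eq_or_eq_neg] at hs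
    rcases hs with hs | hs
    · exact ⟨-1, by norm_num, by rw [hs, hw]; ring, by rw [hL, hw]; ring⟩
    · exact ⟨1, by norm_num, by rw [hs, hw]; ring, by rw [hL, hw]; ring⟩
  · obtain ⟨ε, hε, h2⟩ : ∃ ε : ℝ, ε ^ 2 = 1 ∧
        2 * linForm k x y * z + quadForm k x y * w = ε * s * w := by
      have : (2 * linForm k x y * z + quadForm k x y * w) ^ 2 = (s * w) ^ 2 := by
        rw [disc] at hs
        linear_combination 4 * linForm k x y * h.2 - w ^ 2 * hs
      rcases sq_eq_sq_iff_eq_or_eq_neg.1 this with h | h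
      · exact ⟨1, by norm_num, by linarith⟩
      · exact ⟨-1, by norm_num, by linarith⟩
    refine ⟨ε, hε, mul_left_cancel₀ hw ?_, h2⟩
    linear_combination -2 * h.2 + z * h2

/-- Along a path of lines on which the discriminant is nonnegative and vanishes at the start, all
points have the same colour. -/
lemma eq_of_path (hχ : IsConeColouring k χ) {x y : ℝ → ℝ} (hx : Continuous x) (hy : Continuous y)
    (hne : ∀ t ∈ Icc (0 : ℝ) 1, ¬(x t = 0 ∧ y t = 0))
    (hD : ∀ t ∈ Icc (0 : ℝ) 1, 0 ≤ disc k (x t) (y t)) (hD0 : disc k (x 0) (y 0) = 0)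
    {z w z' w' : ℝ} (h : IsResidualRoot k (x 0) (y 0) z w)
    (h' : IsResidualRoot k (x 1) (y 1) z' w') :
    χ (w' * x 1, w' * y 1, z') = χ (w * x 0, w * y 0, z) := by
  set c := χ (w * x 0, w * y 0, z)
  have hcL : Continuous fun t => linForm k (x t) (y t) := by unfold linForm; fun_prop
  have hcQ : Continuous fun t => quadForm k (x t) (y t) := by unfold quadForm; fun_prop
  have hcC : Continuous fun t => cubForm k (x t) (y t) := by unfold cubForm; fun_prop
  have hcD : Continuous fun t => disc k (x t) (y t) := by unfold disc; fun_prop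
  -- the parameters over which some point has colour `d`
  let T : Bool → Set ℝ := fun d => {t | t ∈ Icc (0 : ℝ) 1 ∧ ∃ z w,
    IsResidualRoot k (x t) (y t) z w ∧ χ (w * x t, w * y t, z) = d}
  have hT : ∀ d, IsClosed (T d) := by
    intro d
    let K₀ : Set (ℝ × ℝ × ℝ) := (Icc 0 1 ×ˢ Icc (-1) 1 ×ˢ Icc (-1) 1) ∩
      {q | q.2.1 ^ 2 + q.2.2 ^ 2 = 1 ∧ linForm k (x q.1) (y q.1) * q.2.1 ^ 2
        + quadForm k (x q.1) (y q.1) * q.2.1 * q.2.2 + cubForm k (x q.1) (y q.1) * q.2.2 ^ 2 = 0}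
    have hK₀ : IsCompact K₀ := by
      refine (isCompact_Icc.prod (isCompact_Icc.prod isCompact_Icc)).inter_right ?_
      have hcL₁ : Continuous fun q : ℝ × ℝ × ℝ => linForm k (x q.1) (y q.1) :=
        hcL.comp continuous_fst
      have hcQ₁ : Continuous fun q : ℝ × ℝ × ℝ => quadForm k (x q.1) (y q.1) :=
        hcQ.comp continuous_fst
      have hcC₁ : Continuous fun q : ℝ × ℝ × ℝ => cubForm k (x q.1) (y q.1) :=
        hcC.comp continuous_fst
      exact (isClosed_eq (by fun_prop) (by fun_prop)).inter
        (isClosed_eq (by fun_prop) (by fun_prop))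
    have hroot : ∀ q ∈ K₀, IsResidualRoot k (x q.1) (y q.1) q.2.1 q.2.2 := by
      rintro q ⟨-, hq, hq'⟩
      refine ⟨?_, hq'⟩
      rintro ⟨h1, h2⟩
      rw [h1, h2] at hq
      norm_num at hq
    let ψ : ℝ × ℝ × ℝ → ℝ × ℝ × ℝ := fun q => (q.2.2 * x q.1, q.2.2 * y q.1, q.2.1)
    have hψ : ContinuousOn (χ ∘ ψ) K₀ :=
      hχ.continuousOn.comp (by fun_prop) fun q hq => (hroot q hq).mem_cubicCone (hne q.1 hq.1.1)
    have hK : IsCompact (K₀ ∩ (χ ∘ ψ) ⁻¹' {d}) :=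
      hK₀.of_isClosed_subset (hψ.preimage_isClosed_of_isClosed hK₀.isClosed (isClosed_discrete _))
        inter_subset_left
    convert! (hK.image continuous_fst).isClosed
    ext t
    constructor
    · rintro ⟨ht, z, w, hr, hd⟩
      obtain ⟨z', w', hu, hr', hd'⟩ := hχ.exists_unit_root hr
      refine ⟨(t, z', w'), ⟨⟨⟨ht, ?_, ?_⟩, hu, hr'.2⟩, hd'.trans hd⟩, rfl⟩
      · exact abs_le.1 (abs_le_one_iff_mul_self_le_one.2 (by nlinarith))
      · exact abs_le.1 (abs_le_one_iff_mul_self_le_one.2 (by nlinarith))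
    · rintro ⟨q, ⟨hq, hd⟩, rfl⟩
      exact ⟨hq.1.1, _, _, hroot q hq, hd⟩
  -- the parameters over which every point has colour `c`
  let A : Set ℝ := {t | t ∈ Icc (0 : ℝ) 1 ∧ ∀ z w,
    IsResidualRoot k (x t) (y t) z w → χ (w * x t, w * y t, z) = c}
  have hAT : A ⊆ T c := by
    rintro t ⟨ht, hall⟩
    obtain ⟨z, w, hr⟩ := exists_isResidualRoot (hD t ht)
    exact ⟨ht, z, w, hr, hall z w hr⟩
  have hA : IsClosed A := by
    refine isClosed_of_closure_subset fun t htA => ?_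
    obtain ⟨ht, z₀, w₀, hr₀, hc₀⟩ := (hT c).closure_subset_iff.2 hAT htA
    refine ⟨ht, fun z w hr => ?_⟩
    rcases (hD t ht).eq_or_lt with h0 | hpos
    · rw [← hc₀]
      exact hχ.eq_of_disc_eq_zero (hne t ht) h0.symm hr hr₀
    obtain ⟨ε, hε, e1, e2⟩ := hr.exists_eigenvalue
    let ρz : ℝ → ℝ := fun t => -quadForm k (x t) (y t) * z - 2 * cubForm k (x t) (y t) * w
      + ε * Real.sqrt (disc k (x t) (y t)) * z
    let ρw : ℝ → ℝ := fun t => 2 * linForm k (x t) (y t) * z + quadForm k (x t) (y t) * w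
      + ε * Real.sqrt (disc k (x t) (y t)) * w
    have hρz : Continuous ρz := by fun_prop
    have hρw : Continuous ρw := by fun_prop
    have hspos : 0 < Real.sqrt (disc k (x t) (y t)) := Real.sqrt_pos.2 hpos
    have hε0 : ε ≠ 0 := by rintro rfl; norm_num at hε
    have hfac : 2 * ε * Real.sqrt (disc k (x t) (y t)) ≠ 0 := by positivity
    have hρzt : ρz t = 2 * ε * Real.sqrt (disc k (x t) (y t)) * z := by
      simp only [ρz]; linear_combination e1
    have hρwt : ρw t = 2 * ε * Real.sqrt (disc k (x t) (y t)) * w := by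
      simp only [ρw]; linear_combination e2
    let U : Set ℝ := {t | ¬(ρz t = 0 ∧ ρw t = 0)}
    have hU : IsOpen U :=
      ((isClosed_eq hρz continuous_const).inter (isClosed_eq hρw continuous_const)).isOpen_compl
    have htU : t ∈ U := by
      rintro ⟨h1, h2⟩
      rw [hρzt, mul_eq_zero] at h1
      rw [hρwt, mul_eq_zero] at h2
      exact hr.1 ⟨h1.resolve_left hfac, h2.resolve_left hfac⟩
    have hroot : ∀ t' ∈ Icc (0 : ℝ) 1 ∩ U, IsResidualRoot k (x t') (y t') (ρz t') (ρw t') := by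
      rintro t' ⟨ht', hU'⟩
      refine ⟨hU', ?_⟩
      have hs := Real.sq_sqrt (hD t' ht')
      simp only [ρz, ρw]
      set s := Real.sqrt (disc k (x t') (y t'))
      rw [disc] at hs
      linear_combination (linForm k (x t') (y t') * z ^ 2 + quadForm k (x t') (y t') * z * w
        + cubForm k (x t') (y t') * w ^ 2) * (ε ^ 2 * hs
        + (quadForm k (x t') (y t') ^ 2 - 4 * linForm k (x t') (y t') * cubForm k (x t') (y t'))
          * hε)
    let ψ : ℝ → ℝ × ℝ × ℝ := fun t => (ρw t * x t, ρw t * y t, ρz t)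
    have hψ : ContinuousOn (χ ∘ ψ) (Icc 0 1 ∩ U) :=
      hχ.continuousOn.comp (by fun_prop) fun t' ht' => (hroot t' ht').mem_cubicCone (hne t' ht'.1)
    have hcl : t ∈ closure (A ∩ U) := by
      rw [inter_comm]
      exact hU.inter_closure ⟨htU, htA⟩
    have hsub : A ∩ U ⊆ Icc 0 1 ∩ U := fun t' h => ⟨h.1.1, h.2⟩
    have hmem := ((hψ t ⟨ht, htU⟩).mono hsub).mem_closure hcl
      (t := {c}) (fun t' h => h.1.2 _ _ (hroot t' ⟨h.1.1, h.2⟩))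
    have hval : χ (ψ t) = c := by simpa using hmem
    rw [← hval]
    simp only [ψ, hρzt, hρwt]
    exact (hχ.root_smul hfac _ _ _ _).symm
  have hcover : Icc (0 : ℝ) 1 ⊆ A ∪ T (!c) := by
    intro t ht
    by_cases hall : ∀ z w, IsResidualRoot k (x t) (y t) z w → χ (w * x t, w * y t, z) = c
    · exact Or.inl ⟨ht, hall⟩
    · push Not at hall
      obtain ⟨z, w, hr, hc⟩ := hall
      exact Or.inr ⟨ht, z, w, hr, by simpa [Bool.eq_not] using hc⟩
  by_contra hcon
  obtain ⟨t, -, htA, -, z₁, w₁, hr, hc⟩ := isPreconnected_closed_iff.1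
    (isPreconnected_Icc (a := (0 : ℝ)) (b := 1)) A (T (!c)) hA (hT _) hcover
    ⟨0, by simp, by simp, fun z₁ w₁ hr => hχ.eq_of_disc_eq_zero (hne 0 (by simp)) hD0 hr h⟩
    ⟨1, by simp, by simp, z', w', h', by simpa [Bool.eq_not] using hcon⟩
  rw [htA.2 z₁ w₁ hr] at hc
  simp at hc

/-- If the lines through the base point meeting the cubic again form a star around `g`, then all
points have the same colour as those over `g`. -/
lemma eq_of_discStar_of_root (hχ : IsConeColouring k χ) {g₁ g₂ : ℝ} (hg : ¬(g₁ = 0 ∧ g₂ = 0))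
    (hD : disc k g₁ g₂ = 0) (hstar : DiscStar k g₁ g₂) {z₀ w₀ : ℝ}
    (h₀ : IsResidualRoot k g₁ g₂ z₀ w₀) {x y z w : ℝ} (hxy : ¬(x = 0 ∧ y = 0))
    (h : IsResidualRoot k x y z w) :
    χ (w * x, w * y, z) = χ (w₀ * g₁, w₀ * g₂, z₀) := by
  by_cases hdet : g₁ * y - g₂ * x = 0
  · have hpos : g₁ ^ 2 + g₂ ^ 2 ≠ 0 := by
      rcases not_and_or.1 hg with h | h <;> positivity
    obtain ⟨a, rfl, rfl⟩ : ∃ a, x = a * g₁ ∧ y = a * g₂ := by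
      refine ⟨(x * g₁ + y * g₂) / (g₁ ^ 2 + g₂ ^ 2), ?_, ?_⟩
      · field_simp
        linear_combination -g₂ * hdet
      · field_simp
        linear_combination g₁ * hdet
    have ha : a ≠ 0 := by
      rintro rfl
      simp at hxy
    have hr : IsResidualRoot k g₁ g₂ z (a * w) := by
      refine ⟨by simpa [ha] using h.1, mul_left_cancel₀ ha ?_⟩
      have := h.2
      simp only [linForm, quadForm, cubForm] at this ⊢
      linear_combination this
    rw [← hχ.eq_of_disc_eq_zero hg hD hr h₀]
    congr 2
    · ring
    · congr 1
      ring
  · have key : ∀ x' y' w', g₁ * y' - g₂ * x' ≠ 0 → IsResidualRoot k x' y' z w' →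
        (∀ t ∈ Icc (0 : ℝ) 1, 0 ≤ disc k ((1 - t) * g₁ + t * x') ((1 - t) * g₂ + t * y')) →
        χ (w' * x', w' * y', z) = χ (w₀ * g₁, w₀ * g₂, z₀) := by
      intro x' y' w' hdet' hr hnn
      have := hχ.eq_of_path (x := fun t => (1 - t) * g₁ + t * x')
        (y := fun t => (1 - t) * g₂ + t * y') (by fun_prop) (by fun_prop) ?_ hnn
        (by simpa using hD) (z := z₀) (w := w₀) (by simpa using h₀) (z' := z) (w' := w')
        (by simpa using hr)
      · simpa using this
      · rintro t - ⟨h1, h2⟩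
        have e1 : (1 - t) * (g₁ * y' - g₂ * x') = 0 := by linear_combination y' * h1 - x' * h2
        have e2 : t * (g₁ * y' - g₂ * x') = 0 := by linear_combination g₁ * h2 - g₂ * h1
        exact hdet' (by linear_combination e1 + e2)
    rcases hstar x y h.disc_nonneg with hnn | hnn
    · exact key x y w hdet h hnn
    · have := key (-x) (-y) (-w) (by contrapose! hdet; linarith) ⟨by simpa using h.1, ?_⟩ hnn
      · simpa using this
      · have := h.2
        simp only [linForm, quadForm, cubForm] at this ⊢
        linear_combination -this

/-- A colouring of the cone is constant as soon as the lines through the base point meeting the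
cubic again form a star around a zero of the discriminant. -/
lemma eq_of_discStar (hχ : IsConeColouring k χ) {g₁ g₂ : ℝ} (hg : ¬(g₁ = 0 ∧ g₂ = 0))
    (hD : disc k g₁ g₂ = 0) (hstar : DiscStar k g₁ g₂) {p p' : ℝ × ℝ × ℝ}
    (hp : p ∈ cubicCone k) (hp' : p' ∈ cubicCone k) : χ p = χ p' := by
  obtain ⟨z₀, w₀, h₀⟩ := exists_isResidualRoot hD.ge
  suffices H : ∀ q ∈ cubicCone k, χ q = χ (w₀ * g₁, w₀ * g₂, z₀) by rw [H p hp, H p' hp']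
  rintro ⟨x, y, z⟩ ⟨hne, hq⟩
  by_cases hxy : x = 0 ∧ y = 0
  · obtain ⟨rfl, rfl⟩ := hxy
    have hz : z ≠ 0 := by
      rintro rfl
      exact hne rfl
    obtain ⟨v₁, v₂, hv, hL⟩ := exists_ne_zero_mul_add_mul_eq_zero (k 0) (k 1)
    have := hχ.eq_of_discStar_of_root hg hD hstar h₀ (z := z) (w := 0) hv
      ⟨by simpa using hz, by rw [linForm]; linear_combination z ^ 2 * hL⟩
    simpa using this
  · have := hχ.eq_of_discStar_of_root hg hD hstar h₀ (z := z) (w := 1) hxy ⟨by simp, ?_⟩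
    · simpa using this
    · simp only [cubicThrough, linForm, quadForm, cubForm] at hq ⊢
      linear_combination hq

end IsConeColouring

lemma cubicThrough_comb (k₀ k₁ : Fin 9 → ℝ) (p q x y z : ℝ) :
    cubicThrough (p • k₀ + q • k₁) x y z =
      p * cubicThrough k₀ x y z + q * cubicThrough k₁ x y z := by
  simp only [cubicThrough, linForm, quadForm, cubForm, Pi.add_apply, Pi.smul_apply, smul_eq_mul]
  ring

lemma exists_eval_eq_cubicThrough_add {F : MvPolynomial (Fin 3) ℝ} (hF : F.IsHomogeneous 3)
    (T : (Fin 3 → ℝ) →ₗ[ℝ] (Fin 3 → ℝ)) :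
    ∃ (k : Fin 9 → ℝ) (c : ℝ), ∀ x y z,
      MvPolynomial.eval (T ![x, y, z]) F = cubicThrough k x y z + c * z ^ 3 := by
  have hT : ∀ x y z i, T ![x, y, z] i = x * T ![1, 0, 0] i + y * T ![0, 1, 0] i
      + z * T ![0, 0, 1] i := by
    intro x y z i
    have : (![x, y, z] : Fin 3 → ℝ) = x • ![1, 0, 0] + y • ![0, 1, 0] + z • ![0, 0, 1] := by
      ext j; fin_cases j <;> simp
    rw [this, map_add, map_add, map_smul, map_smul, map_smul]
    rfl
  rw [← MvPolynomial.support_sum_monomial_coeff F]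
  refine Finset.sum_induction _ (fun G => ∃ (k : Fin 9 → ℝ) (c : ℝ), ∀ x y z,
    MvPolynomial.eval (T ![x, y, z]) G = cubicThrough k x y z + c * z ^ 3) ?_ ?_ ?_
  · rintro G H ⟨k, c, hG⟩ ⟨k', c', hH⟩
    refine ⟨(1 : ℝ) • k + (1 : ℝ) • k', c + c', fun x y z => ?_⟩
    rw [map_add, hG, hH, cubicThrough_comb]
    ring
  · exact ⟨0, 0, fun x y z => by simp [cubicThrough, linForm, quadForm, cubForm]⟩
  · intro d hd
    have hdeg : Multiset.card (Finsupp.toMultiset d) = 3 := by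
      rw [Finsupp.card_toMultiset]
      have h3 : d.degree = 3 := by
        rw [Finsupp.degree_eq_weight_one]
        exact hF (MvPolynomial.mem_support_iff.1 hd)
      exact h3
    obtain ⟨i, j, l, hijl⟩ := Multiset.card_eq_three.1 hdeg
    have heval : ∀ u : Fin 3 → ℝ, MvPolynomial.eval u (MvPolynomial.monomial d (F.coeff d))
        = F.coeff d * (u i * u j * u l) := by
      intro u
      have hd' : d = Finsupp.single i 1 + Finsupp.single j 1 + Finsupp.single l 1 := by
        rw [Finsupp.toMultiset_eq_iff.1 hijl, Multiset.insert_eq_cons, Multiset.insert_eq_cons,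
          ← Multiset.singleton_add, ← Multiset.singleton_add, Multiset.toFinsupp_add,
          Multiset.toFinsupp_add]
        simp [add_assoc]
      rw [MvPolynomial.eval_monomial]
      congr 1
      rw [hd', Finsupp.prod_add_index' (by simp) (by intros; exact pow_add _ _ _),
        Finsupp.prod_add_index' (by simp) (by intros; exact pow_add _ _ _)]
      simp
    set m := F.coeff d
    let a := T ![1, 0, 0]
    let b := T ![0, 1, 0]
    let c := T ![0, 0, 1]
    refine ⟨![m * (a i * c j * c l + c i * a j * c l + c i * c j * a l),
      m * (b i * c j * c l + c i * b j * c l + c i * c j * b l),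
      m * (a i * a j * c l + a i * c j * a l + c i * a j * a l),
      m * (a i * b j * c l + a i * c j * b l + c i * a j * b l
        + b i * a j * c l + b i * c j * a l + c i * b j * a l),
      m * (b i * b j * c l + b i * c j * b l + c i * b j * b l),
      m * (a i * a j * a l),
      m * (a i * a j * b l + a i * b j * a l + b i * a j * a l),
      m * (b i * b j * a l + b i * a j * b l + a i * b j * b l),
      m * (b i * b j * b l)], m * (c i * c j * c l), fun x y z => ?_⟩
    rw [heval, hT x y z i, hT x y z j, hT x y z l]
    simp only [cubicThrough, linForm, quadForm, cubForm, Matrix.cons_val, a, b, c]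
    ring

/-- In coordinates in which a point of the cubic is `[0 : 0 : 1]`, the cubic has no `z³` term. -/
lemma exists_eval_eq_cubicThrough {F : MvPolynomial (Fin 3) ℝ} (hF : F.IsHomogeneous 3)
    (T : (Fin 3 → ℝ) →ₗ[ℝ] (Fin 3 → ℝ)) (h0 : MvPolynomial.eval (T ![0, 0, 1]) F = 0) :
    ∃ k : Fin 9 → ℝ, ∀ x y z, MvPolynomial.eval (T ![x, y, z]) F = cubicThrough k x y z := by
  obtain ⟨k, c, h⟩ := exists_eval_eq_cubicThrough_add hF T
  have hc : c = 0 := by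
    rw [h] at h0
    simpa [cubicThrough, linForm, quadForm, cubForm] using h0
  exact ⟨k, fun x y z => by rw [h, hc]; ring⟩

lemma eval_smul_of_isHomogeneous {F : MvPolynomial (Fin 3) ℝ} {n : ℕ} (hF : F.IsHomogeneous n)
    (c : ℝ) (u : Fin 3 → ℝ) :
    MvPolynomial.eval (c • u) F = c ^ n * MvPolynomial.eval u F := by
  rw [MvPolynomial.eval_eq', MvPolynomial.eval_eq', Finset.mul_sum]
  refine Finset.sum_congr rfl fun d hd => ?_
  have hdeg : ∑ i, d i = n := by
    rw [← Finsupp.degree_eq_sum, Finsupp.degree_eq_weight_one]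
    exact hF (MvPolynomial.mem_support_iff.1 hd)
  simp only [Pi.smul_apply, smul_eq_mul, mul_pow, Finset.prod_mul_distrib,
    Finset.prod_pow_eq_pow_sum, hdeg]
  ring

lemma mk_mem_zeroSet {F : MvPolynomial (Fin 3) ℝ} {n : ℕ} (hF : F.IsHomogeneous n)
    {u : Fin 3 → ℝ} (hu : u ≠ 0) :
    Projectivization.mk ℝ u hu ∈ zeroSet F ↔ MvPolynomial.eval u F = 0 := by
  obtain ⟨c, hc⟩ := Projectivization.exists_smul_eq_mk_rep ℝ u hu
  rw [zeroSet, mem_ofPred_eq, ← hc, Units.smul_def, eval_smul_of_isHomogeneous hF]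
  simp

lemma continuous_mk : Continuous fun u : {u : Fin 3 → ℝ // u ≠ 0} =>
    (Projectivization.mk ℝ u.1 u.2 : RP2) :=
  continuous_quotient_mk'

/-- The cubic is connected once every colouring of its cone is constant. -/
lemma isConnected_zeroSet {F : MvPolynomial (Fin 3) ℝ} {n : ℕ} (hF : F.IsHomogeneous n)
    (T : (Fin 3 → ℝ) ≃L[ℝ] (Fin 3 → ℝ)) {k : Fin 9 → ℝ}
    (hk : ∀ x y z, MvPolynomial.eval (T ![x, y, z]) F = cubicThrough k x y z)
    (hconst : ∀ χ, IsConeColouring k χ → ∀ p ∈ cubicCone k, ∀ p' ∈ cubicCone k, χ p = χ p') :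
    IsConnected (zeroSet F) := by
  let A : ℝ × ℝ × ℝ → Fin 3 → ℝ := fun p => T ![p.1, p.2.1, p.2.2]
  have hA : Continuous A := T.continuous.comp (by fun_prop)
  have hA0 : ∀ p, p ≠ 0 → A p ≠ 0 := by
    intro p hp h
    refine hp ?_
    have h' : ![p.1, p.2.1, p.2.2] = (0 : Fin 3 → ℝ) := T.map_eq_zero_iff.1 h
    exact Prod.ext (congrFun h' 0) (Prod.ext (congrFun h' 1) (congrFun h' 2))
  have hAsmul : ∀ (c : ℝ) p, A (c • p) = c • A p := by
    intro c p
    simp only [A, ← map_smul]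
    simp
  have hA_surj : ∀ u, ∃ p, A p = u := by
    intro u
    refine ⟨(T.symm u 0, T.symm u 1, T.symm u 2), ?_⟩
    have : ![T.symm u 0, T.symm u 1, T.symm u 2] = T.symm u := by
      ext j; fin_cases j <;> rfl
    simp [A, this]
  have hmem : ∀ p (hp : p ≠ 0), p ∈ cubicCone k ↔
      Projectivization.mk ℝ (A p) (hA0 p hp) ∈ zeroSet F := by
    intro p hp
    rw [mk_mem_zeroSet hF]
    simp [A, hk, cubicCone, hp]
  have hlift : ∀ q ∈ zeroSet F, ∃ p, ∃ hp : p ≠ 0, p ∈ cubicCone k ∧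
      Projectivization.mk ℝ (A p) (hA0 p hp) = q := by
    intro q hq
    obtain ⟨p, hp⟩ := hA_surj q.rep
    have hp0 : p ≠ 0 := by
      rintro rfl
      refine q.rep_nonzero ?_
      rw [← hp, ← zero_smul ℝ (0 : ℝ × ℝ × ℝ), hAsmul, zero_smul]
    have hq' : Projectivization.mk ℝ (A p) (hA0 p hp0) = q := by
      conv_rhs => rw [← q.mk_rep]
      congr
    exact ⟨p, hp0, (hmem p hp0).2 (hq' ▸ hq), hq'⟩
  have h01 : ((0, 0, 1) : ℝ × ℝ × ℝ) ≠ 0 := by simp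
  refine ⟨⟨_, (hmem (0, 0, 1) h01).1
    ⟨h01, by simp [cubicThrough, linForm, quadForm, cubForm]⟩⟩, ?_⟩
  refine isPreconnected_of_forall_constant fun f hf q hq q' hq' => ?_
  classical
  let χ : ℝ × ℝ × ℝ → Bool := fun p =>
    if hp : p ≠ 0 then f (Projectivization.mk ℝ (A p) (hA0 p hp)) else false
  have hχ : IsConeColouring k χ := by
    constructor
    · have hmk : Continuous fun p : cubicCone k =>
          (Projectivization.mk ℝ (A p.1) (hA0 p.1 p.2.1) : RP2) :=
        continuous_mk.comp (Continuous.subtype_mk (hA.comp continuous_subtype_val) fun p =>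
          hA0 p.1 p.2.1)
      rw [continuousOn_iff_continuous_domRestrict]
      refine (hf.comp_continuous hmk fun p => (hmem p.1 p.2.1).1 p.2).congr fun p => ?_
      have hp : (p : ℝ × ℝ × ℝ) ≠ 0 := p.2.1
      simp [χ, hp]
    · intro c hc p
      by_cases hp : p = 0
      · simp [hp]
      · have hcp : c • p ≠ 0 := smul_ne_zero hc hp
        simp only [χ, dif_pos hp, dif_pos hcp, ne_eq]
        congr 1
        rw [Projectivization.mk_eq_mk_iff']
        exact ⟨c, (hAsmul c p).symm⟩
  obtain ⟨p, hp0, hp, rfl⟩ := hlift q hq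
  obtain ⟨p', hp0', hp', rfl⟩ := hlift q' hq'
  simpa [χ, hp0, hp0'] using hconst χ hχ p hp p' hp'

lemma exists_common_zero {F₀ F₁ : MvPolynomial (Fin 3) ℝ}
    (h₀ : F₀.IsHomogeneous 3) (h₁ : F₁.IsHomogeneous 3) :
    ∃ u : Fin 3 → ℝ, u ≠ 0 ∧ MvPolynomial.eval u F₀ = 0 ∧ MvPolynomial.eval u F₁ = 0 := by
  let f : (Fin 3 → ℝ) → ℂ := fun u =>
    Complex.equivRealProdCLM.symm (MvPolynomial.eval u F₀, MvPolynomial.eval u F₁)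
  have hf : Continuous f := Complex.equivRealProdCLM.symm.continuous.comp
    ((MvPolynomial.continuous_eval F₀).prodMk (MvPolynomial.continuous_eval F₁))
  have hodd : ∀ u, f (-u) = -f u := by
    intro u
    simp only [f]
    rw [← neg_one_smul ℝ u, eval_smul_of_isHomogeneous h₀, eval_smul_of_isHomogeneous h₁,
      ← map_neg]
    congr 1
    ext <;> simp <;> ring
  obtain ⟨u, hu, h⟩ := exists_ne_zero_eq_zero_of_odd hf hodd
  have h' : (MvPolynomial.eval u F₀, MvPolynomial.eval u F₁) = ((0, 0) : ℝ × ℝ) :=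
    Complex.equivRealProdCLM.symm.map_eq_zero_iff.1 h
  exact ⟨u, hu, congrArg Prod.fst h', congrArg Prod.snd h'⟩

/-- In any real pencil of cubics there is a real cubic with nonempty connected real point set:
if `F₀`, `F₁` are linearly independent homogeneous cubics, then `λ₀ F₀ + λ₁ F₁` has nonempty
connected real point set in `ℝP²` for some `(λ₀, λ₁) ≠ (0, 0)`. -/
theorem stmt_19 (F₀ F₁ : MvPolynomial (Fin 3) ℝ)
    (h₀ : F₀.IsHomogeneous 3) (h₁ : F₁.IsHomogeneous 3)
    (hind : LinearIndependent ℝ ![F₀, F₁]) :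
    ∃ l₀ l₁ : ℝ, ¬ (l₀ = 0 ∧ l₁ = 0) ∧
      IsConnected (zeroSet (l₀ • F₀ + l₁ • F₁)) := by
  obtain ⟨b, hb, hb₀, hb₁⟩ := exists_common_zero h₀ h₁
  obtain ⟨T, rfl⟩ := SeparatingDual.exists_continuousLinearEquiv_apply_eq (R := ℝ)
    (x := (![0, 0, 1] : Fin 3 → ℝ)) (by simp) hb
  obtain ⟨k₀, hk₀⟩ := exists_eval_eq_cubicThrough h₀ T.toLinearMap hb₀
  obtain ⟨k₁, hk₁⟩ := exists_eval_eq_cubicThrough h₁ T.toLinearMap hb₁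
  obtain ⟨p, q, hpq, g₁, g₂, hg, hD, hstar⟩ := exists_discStar k₀ k₁
  refine ⟨p, q, hpq, isConnected_zeroSet (n := 3) (k := p • k₀ + q • k₁) ?_ T ?_ ?_⟩
  · exact (MvPolynomial.homogeneousSubmodule (Fin 3) ℝ 3).add_mem
      (Submodule.smul_mem _ p h₀) (Submodule.smul_mem _ q h₁)
  · intro x y z
    rw [cubicThrough_comb, ← hk₀, ← hk₁]
    simp
  · exact fun χ hχ v hv v' hv' => hχ.eq_of_discStar hg hD hstar hv hv'
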